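/- arXiv:1812.05792 — 2 statements merged into one kernel-verified Lean document; each statement's English description precedes it below -/
import Mathlib

section
/- For any points x_1, ..., x_n ∈ X, let P ∈ ℝ^{n×n} be the proximity matrix P_{ij} = K_T(x_i, x_j) and let D_{ij} = 1 − P_{ij}. Then D is (twice) a squared Euclidean distance matrix: there exist a finite-dimensional real inner product space and vectors v_1, ..., v_n in it such that ‖v_i − v_j‖² = 2·D_{ij} = 2·(1 − K_T(x_i, x_j)) for all i, j. -/
/-- The proximity function of a forest of `T` trees, where `f t x` is the terminal
node (cell) of tree `t` containing the point `x`. -/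
noncomputable def proximity {X C : Type*} [DecidableEq C] (T : ℕ)
    (f : Fin T → X → C) (x z : X) : ℝ :=
  ((Finset.univ.filter fun t : Fin T => f t x = f t z).card : ℝ) / T

/-- The matrix `D_{ij} = 1 - K_T(x_i, x_j)` is (twice) a squared Euclidean distance
matrix: there is a finite-dimensional real inner product space (a Euclidean space)
and points `v_1, …, v_n` in it with `‖v i - v j‖² = 2 (1 - K_T(x_i, x_j))`. -/
theorem proximity_euclidean_distance_matrix {X C : Type*} [DecidableEq C]
    (T : ℕ) (hT : 1 ≤ T) (f : Fin T → X → C) (n : ℕ) (x : Fin n → X) :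
    ∃ (d : ℕ) (v : Fin n → EuclideanSpace ℝ (Fin d)),
      ∀ i j : Fin n, ‖v i - v j‖ ^ 2 = 2 * (1 - proximity T f (x i) (x j)) := by
  classical
  let A : Finset C := Finset.univ.image fun p : Fin T × Fin n => f p.1 (x p.2)
  have hA : ∀ t i, f t (x i) ∈ A := fun t i =>
    Finset.mem_image.2 ⟨(t, i), Finset.mem_univ _, rfl⟩
  let g : Fin T → Fin n → A := fun t i => ⟨f t (x i), hA t i⟩
  let e := Fintype.equivFin (Fin T × A)
  let s : ℝ := (Real.sqrt T)⁻¹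
  have hT0 : (T : ℝ) ≠ 0 := by
    have : T ≠ 0 := by omega
    exact_mod_cast this
  have hs : s ^ 2 = (T : ℝ)⁻¹ := by
    simp only [s, inv_pow]
    rw [Real.sq_sqrt (Nat.cast_nonneg T)]
  refine ⟨Fintype.card (Fin T × A), fun i => WithLp.toLp 2 fun k =>
    if g (e.symm k).1 i = (e.symm k).2 then s else 0, fun i j => ?_⟩
  have key : ∀ a b : A, ∑ c : A, ((if a = c then s else 0) - (if b = c then s else 0)) ^ 2
      = 2 * s ^ 2 - 2 * s ^ 2 * (if a = b then 1 else 0) := by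
    intro a b
    have h : ∀ c : A, ((if a = c then s else 0) - (if b = c then s else 0)) ^ 2
        = (if a = c then s ^ 2 else 0) + (if b = c then s ^ 2 else 0)
          - 2 * (if a = c then (if b = a then s ^ 2 else 0) else 0) := by
      intro c
      by_cases h1 : a = c
      · subst h1
        by_cases h2 : b = a <;> simp [h2] <;> ring
      · by_cases h2 : b = c <;> simp [h1, h2]
    simp only [h, Finset.sum_sub_distrib, Finset.sum_add_distrib, ← Finset.mul_sum,
      Finset.sum_ite_eq, Finset.mem_univ, if_true]
    by_cases h2 : a = b
    · simp [h2]
      ring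
    · simp [h2, Ne.symm h2]
      ring
  rw [EuclideanSpace.norm_sq_eq]
  simp only [PiLp.sub_apply, Real.norm_eq_abs, sq_abs]
  rw [e.symm.sum_comp (fun p : Fin T × A =>
    ((if g p.1 i = p.2 then s else 0) - (if g p.1 j = p.2 then s else 0)) ^ 2),
    Fintype.sum_prod_type]
  simp only [key, Finset.sum_sub_distrib, ← Finset.mul_sum, Finset.sum_boole, hs, g,
    Subtype.mk.injEq, proximity, Finset.sum_const, Finset.card_univ, Fintype.card_fin,
    nsmul_eq_mul]
  field_simp
end

section
/- Let k ≥ 1 be an integer and x ∈ (0, 1], and set w = −ln x ≥ 0. Then the k-dimensional Lebesgue measure of {u ∈ [0,1]^k : Π_{i=1}^k u_i ≥ x} equals the upper tail probability of a Poisson random variable with parameter w evaluated at k: it equals Σ_{i=k}^∞ e^{−w} · w^i / i!. -/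
open MeasureTheory

/-- Closed form of the volume. -/
noncomputable def prodTail (k : ℕ) (x : ℝ) : ℝ :=
  1 - x * ∑ i ∈ Finset.range k, (-Real.log x) ^ i / (Nat.factorial i : ℝ)

lemma prodTail_nonneg (k : ℕ) (x : ℝ) (hx : x ∈ Set.Ioc (0 : ℝ) 1) : 0 ≤ prodTail k x := by
  have h0 : 0 ≤ -Real.log x := by
    have := Real.log_nonpos hx.1.le hx.2
    linarith
  have h := Real.sum_le_exp_of_nonneg h0 k
  rw [Real.exp_neg, Real.exp_log hx.1] at h
  have := mul_le_mul_of_nonneg_left h hx.1.le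
  rw [mul_inv_cancel₀ hx.1.ne'] at this
  unfold prodTail
  linarith

lemma prodTail_tsum (k : ℕ) (x : ℝ) (hx : x ∈ Set.Ioc (0 : ℝ) 1) (w : ℝ)
    (hw : w = -Real.log x) :
    (∑' i : ℕ, if k ≤ i then Real.exp (-w) * w ^ i / (Nat.factorial i : ℝ) else 0)
      = prodTail k x := by
  have hex : Real.exp (-w) = x := by rw [hw, neg_neg, Real.exp_log hx.1]
  have h1 : HasSum (fun i : ℕ => x * (w ^ i / (Nat.factorial i : ℝ))) 1 := by
    have h := (NormedSpace.expSeries_div_hasSum_exp (𝔸 := ℝ) w).mul_left x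
    rw [← Real.exp_eq_exp_ℝ, ← hex, ← Real.exp_add, neg_add_cancel, Real.exp_zero, hex] at h
    exact h
  have h2 : HasSum (fun i : ℕ => if i < k then x * (w ^ i / (Nat.factorial i : ℝ)) else 0)
      (∑ i ∈ Finset.range k, if i < k then x * (w ^ i / (Nat.factorial i : ℝ)) else 0) := by
    apply hasSum_sum_of_ne_finset_zero
    intro b hb
    rw [if_neg (by simpa using hb)]
  have h3 := h1.sub h2
  have h4 := h3.tsum_eq
  unfold prodTail
  rw [← hw, Finset.mul_sum]
  have h5 : (∑ i ∈ Finset.range k, if i < k then x * (w ^ i / (Nat.factorial i : ℝ)) else 0)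
      = ∑ i ∈ Finset.range k, x * (w ^ i / (Nat.factorial i : ℝ)) :=
    Finset.sum_congr rfl fun i hi => if_pos (Finset.mem_range.1 hi)
  rw [← h5, ← h4]
  congr 1
  ext i
  rw [hex]
  by_cases h : k ≤ i
  · rw [if_pos h, if_neg (by omega), mul_div_assoc, sub_zero]
  · rw [if_neg h, if_pos (by omega), sub_self]

lemma prodTail_continuousOn (k : ℕ) (x : ℝ) (hx : x ∈ Set.Ioc (0 : ℝ) 1) :
    ContinuousOn (fun t => prodTail k (x / t)) (Set.Icc x 1) := by
  unfold prodTail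
  have hne : ∀ t ∈ Set.Icc x 1, t ≠ 0 := fun t ht => (hx.1.trans_le ht.1).ne'
  have hd : ContinuousOn (fun t => x / t) (Set.Icc x 1) :=
    continuousOn_const.div continuousOn_id hne
  have hl : ContinuousOn (fun t => Real.log (x / t)) (Set.Icc x 1) :=
    hd.log fun t ht => div_ne_zero hx.1.ne' (hne t ht)
  refine continuousOn_const.sub (hd.mul (continuousOn_finsetSum _ fun i _ => ?_))
  exact (hl.neg.pow i).div_const _

lemma prodTail_integral (k : ℕ) (x : ℝ) (hx : x ∈ Set.Ioc (0 : ℝ) 1) :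
    ∫ t in x..1, prodTail k (x / t) = prodTail (k + 1) x := by
  have huIcc : Set.uIcc x 1 = Set.Icc x 1 := Set.uIcc_of_le hx.2
  rw [intervalIntegral.integral_eq_sub_of_hasDerivAt (f := fun t => t - x *
    ∑ i ∈ Finset.range k, (Real.log t - Real.log x) ^ (i + 1) / (Nat.factorial (i + 1) : ℝ))]
  · unfold prodTail
    rw [Finset.sum_range_succ']
    simp
    ring
  · intro t ht
    rw [huIcc] at ht
    have ht0 : 0 < t := hx.1.trans_le ht.1
    have hs : HasDerivAt (fun t => ∑ i ∈ Finset.range k,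
        (Real.log t - Real.log x) ^ (i + 1) / (Nat.factorial (i + 1) : ℝ))
        (∑ i ∈ Finset.range k, t⁻¹ * ((Real.log t - Real.log x) ^ i / (Nat.factorial i : ℝ))) t := by
      apply HasDerivAt.fun_sum
      intro i _
      have h := ((((Real.hasDerivAt_log ht0.ne').sub_const (Real.log x)).pow (i + 1)).div_const
        (Nat.factorial (i + 1) : ℝ))
      refine h.congr_deriv ?_
      have : (Nat.factorial i : ℝ) ≠ 0 := by positivity
      rw [Nat.factorial_succ]
      push_cast
      field_simp
    refine ((hasDerivAt_id t).sub (hs.const_mul x)).congr_deriv ?_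
    unfold prodTail
    rw [Real.log_div hx.1.ne' ht0.ne', neg_sub, ← Finset.mul_sum, div_eq_mul_inv, mul_assoc]
  · apply ContinuousOn.intervalIntegrable
    rw [huIcc]
    exact prodTail_continuousOn k x hx

lemma measurableSet_prodSet (k : ℕ) (x : ℝ) :
    MeasurableSet {u : Fin k → ℝ | (∀ i, u i ∈ Set.Icc (0 : ℝ) 1) ∧ x ≤ ∏ i, u i} := by
  apply IsClosed.measurableSet
  simp only [Set.mem_Icc, Set.setOf_and, Set.setOf_forall]
  refine IsClosed.inter (isClosed_iInter fun i => IsClosed.inter ?_ ?_) ?_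
  · exact isClosed_le (by fun_prop) (by fun_prop)
  · exact isClosed_le (by fun_prop) (by fun_prop)
  · exact isClosed_le (by fun_prop) (by fun_prop)

lemma volume_prodSet (k : ℕ) : ∀ x ∈ Set.Ioc (0 : ℝ) 1,
    volume {u : Fin k → ℝ | (∀ i, u i ∈ Set.Icc (0 : ℝ) 1) ∧ x ≤ ∏ i, u i} =
      ENNReal.ofReal (prodTail k x) := by
  induction k with
  | zero =>
    intro x hx
    have : {u : Fin 0 → ℝ | (∀ i, u i ∈ Set.Icc (0 : ℝ) 1) ∧ x ≤ ∏ i, u i} = Set.univ := by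
      ext u
      simp [hx.2]
    rw [this]
    simp [prodTail, volume_pi]
  | succ k ih =>
    intro x hx
    have mp := (volume_preserving_piFinSuccAbove (fun _ : Fin (k + 1) => ℝ) 0).symm
    rw [← mp.measure_preimage (measurableSet_prodSet (k + 1) x).nullMeasurableSet,
      Measure.volume_eq_prod,
      Measure.prod_apply (mp.measurable (measurableSet_prodSet (k + 1) x))]
    rw [← prodTail_integral k x hx, intervalIntegral.integral_of_le hx.2,
      ← integral_Icc_eq_integral_Ioc, ofReal_integral_eq_lintegral_ofReal,
      ← lintegral_indicator measurableSet_Icc]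
    · congr 1
      ext t
      by_cases ht : t ∈ Set.Icc x 1
      · have ht0 : 0 < t := hx.1.trans_le ht.1
        rw [Set.indicator_of_mem ht,
          ← ih (x / t) ⟨div_pos hx.1 ht0, (div_le_one ht0).2 ht.1⟩]
        congr 1
        ext v
        simp [Fin.forall_fin_succ, Fin.prod_univ_succ, div_le_iff₀' ht0, ht0.le, ht.2,
          MeasurableEquiv.piFinSuccAbove]
      · rw [Set.indicator_of_notMem ht]
        convert measure_empty (μ := (volume : Measure (Fin k → ℝ)))
        ext v
        simp only [Set.mem_preimage, Set.mem_setOf_eq, Set.mem_empty_iff_false, iff_false]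
        rintro ⟨h1, h2⟩
        simp [Fin.forall_fin_succ, MeasurableEquiv.piFinSuccAbove] at h1
        simp [Fin.prod_univ_succ, MeasurableEquiv.piFinSuccAbove] at h2
        apply ht
        refine ⟨h2.trans ?_, h1.1.2⟩
        exact mul_le_of_le_one_right h1.1.1
          (Finset.prod_le_one (fun i _ => (h1.2 i).1) fun i _ => (h1.2 i).2)
    · exact (prodTail_continuousOn k x hx).integrableOn_Icc
    · refine (ae_restrict_iff' measurableSet_Icc).2 (Filter.Eventually.of_forall fun t ht => ?_)
      have ht0 : 0 < t := hx.1.trans_le ht.1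
      exact prodTail_nonneg k _ ⟨div_pos hx.1 ht0, (div_le_one ht0).2 ht.1⟩

/-- Poisson tail form: with `w = -ln x`, the `k`-dimensional Lebesgue measure of
`{u ∈ [0,1]^k : ∏ u_i ≥ x}` equals the upper tail probability at `k` of a Poisson
random variable with parameter `w`: `∑_{i=k}^∞ e^{-w} w^i / i!`. -/
theorem volume_prod_unif_ge_poisson_tail (k : ℕ) (hk : 1 ≤ k)
    (x : ℝ) (hx : x ∈ Set.Ioc (0 : ℝ) 1) (w : ℝ) (hw : w = -Real.log x) :
    volume {u : Fin k → ℝ | (∀ i, u i ∈ Set.Icc (0 : ℝ) 1) ∧ x ≤ ∏ i, u i} =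
      ENNReal.ofReal
        (∑' i : ℕ, if k ≤ i then Real.exp (-w) * w ^ i / (Nat.factorial i : ℝ) else 0) := by
  rw [prodTail_tsum k x hx w hw]
  exact volume_prodSet k x hx
end
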